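/- arXiv:1208.6399 — 3 statements merged into one kernel-verified Lean document; each statement's English description precedes it below -/
import Mathlib

section
/- Let α > 0, δ > 0 and β, γ, μ, ν be real numbers satisfying the skew symmetry condition αβ + γδ = 0, together with μα + νγ > 0 and μβ + νδ > 0. Set a = 2α + 1, b = 2δ + 1, c = 2δ(μα + νγ)/(αδ − βγ), d = 2α(μβ + νδ)/(αδ − βγ) (note that αδ − βγ > 0 under skew symmetry), and define ρ(x,y) = x^{a−1}e^{−cx}·y^{b−1}e^{−dy} for x > 0, y > 0. Let L be the differential operator Lf = (1/2)(∂²f/∂x² + ∂²f/∂y²) + (α/x + β/y − μ)·∂f/∂x + (γ/x + δ/y − ν)·∂f/∂y. Then ρ is Lebesgue integrable on (0,∞) × (0,∞), and for every twice continuously differentiable function f with compact support contained in (0,∞) × (0,∞) one has ∫₀^∞∫₀^∞ Lf(x,y)·ρ(x,y) dx dy = 0. -/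
open MeasureTheory

/-- The unnormalized gamma density with shape `s + 1` and rate `c`. -/
noncomputable def gammaWeight (s c x : ℝ) : ℝ := x ^ s * Real.exp (-c * x)

lemma hasDerivAt_gammaWeight (s c : ℝ) {x : ℝ} (hx : 0 < x) :
    HasDerivAt (gammaWeight s c) ((s / x - c) * gammaWeight s c x) x := by
  have h1 := Real.hasDerivAt_rpow_const (x := x) (p := s) (Or.inl hx.ne')
  have h2 := ((hasDerivAt_id x).const_mul (-c)).exp
  refine (h1.mul h2).congr_deriv ?_
  rw [Real.rpow_sub_one hx.ne']
  simp only [gammaWeight, id]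
  ring

lemma contDiffAt_gammaWeight (s c : ℝ) {x : ℝ} (hx : 0 < x) {n : WithTop ℕ∞} :
    ContDiffAt ℝ n (gammaWeight s c) x :=
  (Real.contDiffAt_rpow_const_of_ne hx.ne').mul (contDiffAt_const.mul contDiffAt_id).exp

lemma integrableOn_gammaWeight {s c : ℝ} (hs : -1 < s) (hc : 0 < c) :
    IntegrableOn (gammaWeight s c) (Set.Ioi 0) := by
  have h := integrableOn_rpow_mul_exp_neg_mul_rpow hs zero_lt_one hc
  simp only [Real.rpow_one] at h
  exact h

lemma integral_fderiv_apply_eq_zero {E : Type*} [NormedAddCommGroup E] [NormedSpace ℝ E]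
    [FiniteDimensional ℝ E] [MeasurableSpace E] [BorelSpace E] (m : Measure E)
    [m.IsAddHaarMeasure] {P : E → ℝ} (hP : ContDiff ℝ 1 P) (hc : HasCompactSupport P) (v : E) :
    ∫ p, fderiv ℝ P p v ∂m = 0 := by
  have hint : Integrable (fun p => fderiv ℝ P p v) m :=
    ((hP.continuous_fderiv one_ne_zero).clm_apply continuous_const).integrable_of_hasCompactSupport
      (hc.fderiv_apply (𝕜 := ℝ) v)
  have h := integral_mul_fderiv_eq_neg_fderiv_mul_of_integrable (μ := m) (𝕜 := ℝ)
    (f := fun _ : E => (1 : ℝ)) (g := P) (v := v) (by simp) (by simpa using hint)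
    (by simpa using hP.continuous.integrable_of_hasCompactSupport hc)
    (fun _ _ => differentiableAt_const _)
    (fun _ _ => hP.differentiable one_ne_zero _)
  simpa using h

lemma DifferentiableAt.hasDerivAt_fst {G : ℝ × ℝ → ℝ} {x y : ℝ}
    (h : DifferentiableAt ℝ G (x, y)) :
    HasDerivAt (fun u => G (u, y)) (fderiv ℝ G (x, y) (1, 0)) x :=
  HasFDerivAt.comp_hasDerivAt x h.hasFDerivAt ((hasDerivAt_id x).prodMk (hasDerivAt_const x y))

lemma DifferentiableAt.hasDerivAt_snd {G : ℝ × ℝ → ℝ} {x y : ℝ}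
    (h : DifferentiableAt ℝ G (x, y)) :
    HasDerivAt (fun v => G (x, v)) (fderiv ℝ G (x, y) (0, 1)) y :=
  HasFDerivAt.comp_hasDerivAt y h.hasFDerivAt ((hasDerivAt_const y x).prodMk (hasDerivAt_id y))

/-- A `C¹` function supported in an open set stays `C¹` when multiplied by a function that is
`C¹` on that set. -/
lemma ContDiff.mul_of_tsupport_subset {E : Type*} [NormedAddCommGroup E] [NormedSpace ℝ E]
    {n : WithTop ℕ∞} {F g : E → ℝ} {U : Set E} (hF : ContDiff ℝ n F) (hU : tsupport F ⊆ U)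
    (hg : ∀ p ∈ U, ContDiffAt ℝ n g p) : ContDiff ℝ n (fun p => F p * g p) := by
  refine contDiff_iff_contDiffAt.2 fun p => ?_
  by_cases hp : p ∈ tsupport F
  · exact hF.contDiffAt.mul (hg p (hU hp))
  · refine (contDiffAt_const (c := (0 : ℝ))).congr_of_eventuallyEq ?_
    filter_upwards [notMem_tsupport_iff_eventuallyEq.1 hp] with q hq
    simp [hq]

/-- If `H` is a divergence `∂ₓP + ∂ᵧQ` in the quadrant with `P`, `Q` compactly supported
in the quadrant, its integral vanishes. -/
lemma integral_quadrant_eq_zero_of_divergence {P Q : ℝ × ℝ → ℝ} (hP : ContDiff ℝ 1 P)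
    (hQ : ContDiff ℝ 1 Q) (hPc : HasCompactSupport P) (hQc : HasCompactSupport Q)
    (hPs : tsupport P ⊆ Set.Ioi 0 ×ˢ Set.Ioi 0) (hQs : tsupport Q ⊆ Set.Ioi 0 ×ˢ Set.Ioi 0)
    {H : ℝ → ℝ → ℝ} (hH : ∀ x y, 0 < x → 0 < y →
      H x y = fderiv ℝ P (x, y) (1, 0) + fderiv ℝ Q (x, y) (0, 1)) :
    ∫ x in Set.Ioi (0 : ℝ), ∫ y in Set.Ioi (0 : ℝ), H x y = 0 := by
  have hint : ∀ {R : ℝ × ℝ → ℝ} (v : ℝ × ℝ), ContDiff ℝ 1 R → HasCompactSupport R →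
      Integrable (fun p => fderiv ℝ R p v) := fun v hR hRc =>
    ((hR.continuous_fderiv one_ne_zero).clm_apply continuous_const).integrable_of_hasCompactSupport
      (hRc.fderiv_apply (𝕜 := ℝ) v)
  have hsum := (hint (1, 0) hP hPc).add (hint (0, 1) hQ hQc)
  calc ∫ x in Set.Ioi (0 : ℝ), ∫ y in Set.Ioi (0 : ℝ), H x y
      = ∫ x in Set.Ioi (0 : ℝ), ∫ y in Set.Ioi (0 : ℝ),
          (fderiv ℝ P (x, y) (1, 0) + fderiv ℝ Q (x, y) (0, 1)) :=
        setIntegral_congr_fun measurableSet_Ioi fun x hx =>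
          setIntegral_congr_fun measurableSet_Ioi fun y hy => hH x y hx hy
    _ = ∫ p in Set.Ioi (0 : ℝ) ×ˢ Set.Ioi (0 : ℝ),
          (fderiv ℝ P p (1, 0) + fderiv ℝ Q p (0, 1)) :=
        (setIntegral_prod (μ := volume) (ν := volume) _ hsum.integrableOn).symm
    _ = ∫ p, (fderiv ℝ P p (1, 0) + fderiv ℝ Q p (0, 1)) := by
        refine setIntegral_eq_integral_of_forall_compl_eq_zero fun p hp => ?_
        rw [fderiv_of_notMem_tsupport ℝ fun h => hp (hPs h),
          fderiv_of_notMem_tsupport ℝ fun h => hp (hQs h)]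
        simp
    _ = 0 := by
        rw [integral_add (hint (1, 0) hP hPc) (hint (0, 1) hQ hQc),
          integral_fderiv_apply_eq_zero _ hP hPc, integral_fderiv_apply_eq_zero _ hQ hQc,
          add_zero]

/-- One component of the flux of `ρ`: the derivative of `(φ'/2 + kφ)w` for a gamma weight `w`. -/
lemma hasDerivAt_flux {φ φ' : ℝ → ℝ} {φ'' x : ℝ} (s c k C : ℝ) (hx : 0 < x)
    (h1 : HasDerivAt φ (φ' x) x) (h2 : HasDerivAt φ' φ'' x) :
    HasDerivAt (fun u => φ' u * (1 / 2 * (gammaWeight s c u * C)) +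
        φ u * (k * (gammaWeight s c u * C)))
      ((1 / 2 * φ'' + (k + s / (2 * x) - c / 2) * φ' x + k * (s / x - c) * φ x) *
        (gammaWeight s c x * C)) x := by
  have hw := (hasDerivAt_gammaWeight s c hx).mul_const C
  refine ((h2.mul (hw.const_mul (1 / 2))).add (h1.mul (hw.const_mul k))).congr_deriv ?_
  field_simp
  ring

/-- Under the skew symmetry condition `αβ + γδ = 0` and `μα + νγ > 0`, `μβ + νδ > 0`,
the (unnormalized) product of gamma densities
`ρ(x,y) = x^{a−1}e^{−cx} y^{b−1}e^{−dy}` with `a = 2α + 1`, `b = 2δ + 1`,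
`c = 2δ(μα + νγ)/(αδ − βγ)`, `d = 2α(μβ + νδ)/(αδ − βγ)` is integrable on the open
quadrant and satisfies `∫∫ Lf · ρ = 0` for every `C²` function `f` with compact support
in `(0,∞) × (0,∞)`, where `L` is the generator of the Brownian motion with drift
`(−μ, −ν)` and oblique electrostatic repulsion. -/
theorem gamma_product_invariant (α β γ δ μ ν : ℝ) (hα : 0 < α) (hδ : 0 < δ)
    (hskew : α * β + γ * δ = 0) (h₁ : 0 < μ * α + ν * γ) (h₂ : 0 < μ * β + ν * δ) :
    let a : ℝ := 2 * α + 1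
    let b : ℝ := 2 * δ + 1
    let c : ℝ := 2 * δ * (μ * α + ν * γ) / (α * δ - β * γ)
    let d : ℝ := 2 * α * (μ * β + ν * δ) / (α * δ - β * γ)
    let ρ : ℝ → ℝ → ℝ := fun x y =>
      x ^ (a - 1) * Real.exp (-c * x) * y ^ (b - 1) * Real.exp (-d * y)
    IntegrableOn (fun p : ℝ × ℝ => ρ p.1 p.2) (Set.Ioi 0 ×ˢ Set.Ioi 0) volume ∧
    ∀ f : ℝ → ℝ → ℝ,
      ContDiff ℝ 2 (Function.uncurry f) →
      HasCompactSupport (Function.uncurry f) →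
      tsupport (Function.uncurry f) ⊆ Set.Ioi 0 ×ˢ Set.Ioi 0 →
      (∫ x in Set.Ioi (0:ℝ), ∫ y in Set.Ioi (0:ℝ),
        ((1/2) * (deriv (deriv (fun u => f u y)) x + deriv (deriv (fun v => f x v)) y)
          + (α / x + β / y - μ) * deriv (fun u => f u y) x
          + (γ / x + δ / y - ν) * deriv (fun v => f x v) y) * ρ x y) = 0 := by
  intro a b c d ρ
  have hD : 0 < α * δ - β * γ := by
    have h : α * (α * δ - β * γ) = δ * (α ^ 2 + γ ^ 2) := by linear_combination -γ * hskew
    have h' : 0 < α * (α * δ - β * γ) := by rw [h]; positivity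
    exact pos_of_mul_pos_right h' hα.le
  have hc : 0 < c := by positivity
  have hd : 0 < d := by positivity
  have hcD : c * (α * δ - β * γ) = 2 * δ * (μ * α + ν * γ) := div_mul_cancel₀ _ hD.ne'
  have hdD : d * (α * δ - β * γ) = 2 * α * (μ * β + ν * δ) := div_mul_cancel₀ _ hD.ne'
  have hμ : α * c - γ * d = 2 * α * μ :=
    mul_right_cancel₀ hD.ne' (by linear_combination α * hcD - γ * hdD)
  have hν : δ * d - β * c = 2 * δ * ν :=
    mul_right_cancel₀ hD.ne' (by linear_combination δ * hdD - β * hcD)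
  have hconst : c * (c / 2 - μ) + d * (d / 2 - ν) = 0 :=
    mul_right_cancel₀ (mul_pos hα hδ).ne'
      (by linear_combination c * δ / 2 * hμ + d * α / 2 * hν + c * d / 2 * hskew)
  have hρ : ∀ x y, ρ x y = gammaWeight (2 * α) c x * gammaWeight (2 * δ) d y := fun x y => by
    simp only [ρ, a, b, gammaWeight, add_sub_cancel_right, mul_assoc]
  clear_value c d ρ
  obtain rfl : ρ = fun x y => gammaWeight (2 * α) c x * gammaWeight (2 * δ) d y :=
    funext₂ hρ
  refine ⟨?_, fun f hf hfc hfs => ?_⟩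
  · rw [IntegrableOn, Measure.volume_eq_prod, ← Measure.prod_restrict]
    exact (integrableOn_gammaWeight (by linarith) hc).mul_prod
      (integrableOn_gammaWeight (by linarith) hd)
  set F := Function.uncurry f with hF
  have hF1 : ContDiff ℝ 1 F := hf.of_le one_le_two
  have hdF : ∀ v, ContDiff ℝ 1 (fun p => fderiv ℝ F p v) := fun v =>
    (hf.fderiv_right (m := 1) (by norm_num)).clm_apply contDiff_const
  have hdFs : ∀ v, tsupport (fun p => fderiv ℝ F p v) ⊆ Set.Ioi 0 ×ˢ Set.Ioi 0 := fun v =>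
    (tsupport_fderiv_apply_subset ℝ v).trans hfs
  let w : ℝ × ℝ → ℝ := fun p => gammaWeight (2 * α) c p.1 * gammaWeight (2 * δ) d p.2
  have hw : ∀ p ∈ Set.Ioi (0 : ℝ) ×ˢ Set.Ioi (0 : ℝ), ContDiffAt ℝ 1 w p := fun p hp =>
    ((contDiffAt_gammaWeight _ _ hp.1).comp p contDiffAt_fst).mul
      ((contDiffAt_gammaWeight _ _ hp.2).comp p contDiffAt_snd)
  -- the flux in direction `v` with zeroth-order coefficient `k`
  let flux : ℝ × ℝ → (ℝ × ℝ → ℝ) → ℝ × ℝ → ℝ := fun v k p =>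
    fderiv ℝ F p v * (1 / 2 * w p) + F p * (k p * w p)
  have hflux : ∀ v k, (∀ p ∈ Set.Ioi (0 : ℝ) ×ˢ Set.Ioi (0 : ℝ), ContDiffAt ℝ 1 k p) →
      ContDiff ℝ 1 (flux v k) := fun v k hk =>
    ((hdF v).mul_of_tsupport_subset (hdFs v) fun p hp => contDiffAt_const.mul (hw p hp)).add
      (hF1.mul_of_tsupport_subset hfs fun p hp => (hk p hp).mul (hw p hp))
  have hfluxs : ∀ v k, tsupport (flux v k) ⊆ tsupport F := fun v k =>
    (tsupport_add _ _).trans (Set.union_subset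
      (tsupport_mul_subset_left.trans (tsupport_fderiv_apply_subset ℝ v))
      tsupport_mul_subset_left)
  have hfluxc : ∀ v k, HasCompactSupport (flux v k) := fun v k =>
    hfc.of_isClosed_subset (isClosed_tsupport _) (hfluxs v k)
  have hP := hflux (1, 0) (fun p => β / p.2 + (c / 2 - μ)) fun p hp =>
    (contDiffAt_const.div contDiffAt_snd (ne_of_gt hp.2)).add contDiffAt_const
  have hQ := hflux (0, 1) (fun p => γ / p.1 + (d / 2 - ν)) fun p hp =>
    (contDiffAt_const.div contDiffAt_fst (ne_of_gt hp.1)).add contDiffAt_const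
  refine integral_quadrant_eq_zero_of_divergence hP hQ (hfluxc _ _) (hfluxc _ _)
    ((hfluxs _ _).trans hfs) ((hfluxs _ _).trans hfs) fun x y hx hy => ?_
  have hx1 : ∀ u, HasDerivAt (fun u => f u y) (fderiv ℝ F (u, y) (1, 0)) u := fun u =>
    (hF1.differentiable one_ne_zero (u, y)).hasDerivAt_fst
  have hy1 : ∀ v, HasDerivAt (fun v => f x v) (fderiv ℝ F (x, v) (0, 1)) v := fun v =>
    (hF1.differentiable one_ne_zero (x, v)).hasDerivAt_snd
  have hx2 := ((hdF (1, 0)).differentiable one_ne_zero (x, y)).hasDerivAt_fst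
  have hy2 := ((hdF (0, 1)).differentiable one_ne_zero (x, y)).hasDerivAt_snd
  have hPx := ((hP.differentiable one_ne_zero (x, y)).hasDerivAt_fst).unique
    (hasDerivAt_flux (2 * α) c (β / y + (c / 2 - μ)) (gammaWeight (2 * δ) d y) hx (hx1 x) hx2)
  have hQy := ((hQ.differentiable one_ne_zero (x, y)).hasDerivAt_snd).unique
    ((hasDerivAt_flux (2 * δ) d (γ / x + (d / 2 - ν)) (gammaWeight (2 * α) c x) hy
      (hy1 y) hy2).congr_of_eventuallyEq
        (Filter.Eventually.of_forall fun v => by simp only [flux, w, hF, Function.uncurry]; ring))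
  have hcoef : (β / y + (c / 2 - μ)) * (2 * α / x - c)
      + (γ / x + (d / 2 - ν)) * (2 * δ / y - d) = 0 := by
    field_simp
    linear_combination 4 * hskew + 2 * y * hμ + 2 * x * hν - 2 * x * y * hconst
  rw [hPx, hQy, funext fun u => (hx1 u).deriv, funext fun v => (hy1 v).deriv, hx2.deriv,
    hy2.deriv]
  simp only [hF, Function.uncurry]
  linear_combination -(f x y * gammaWeight (2 * α) c x * gammaWeight (2 * δ) d y) * hcoef
end

section
/- Let α > 0, δ > 0 and β, γ be real numbers satisfying the skew symmetry condition αβ + γδ = 0. Define ρ(x,y) = x^{2α}·y^{2δ} for x > 0, y > 0, and let L be the differential operator Lf = (1/2)(∂²f/∂x² + ∂²f/∂y²) + (α/x + β/y)·∂f/∂x + (γ/x + δ/y)·∂f/∂y. Then for every twice continuously differentiable function f with compact support contained in (0,∞) × (0,∞) one has ∫₀^∞∫₀^∞ Lf(x,y)·ρ(x,y) dx dy = 0. -/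
open MeasureTheory

/-- The integral of a directional derivative of a compactly supported `C¹` function vanishes. -/
lemma integral_fderiv_apply_eq_zero_s15 {G : ℝ × ℝ → ℝ} (hG : ContDiff ℝ 1 G)
    (hc : HasCompactSupport G) (v : ℝ × ℝ) :
    Integrable (fun p => fderiv ℝ G p v) ∧ ∫ p, fderiv ℝ G p v = 0 := by
  have hcont : Continuous fun p => fderiv ℝ G p v :=
    (hG.continuous_fderiv one_ne_zero).clm_apply continuous_const
  have hint : Integrable (fun p => fderiv ℝ G p v) :=
    hcont.integrable_of_hasCompactSupport (hc.fderiv_apply ℝ v)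
  have : (volume : Measure (ℝ × ℝ)).IsAddHaarMeasure :=
    inferInstanceAs ((volume : Measure ℝ).prod volume).IsAddHaarMeasure
  refine ⟨hint, ?_⟩
  have h := integral_mul_fderiv_eq_neg_fderiv_mul_of_integrable (μ := volume) (v := v)
    (f := fun _ : ℝ × ℝ => (1 : ℝ)) (g := G) (by simp) (by simpa using hint)
    (by simpa using hG.continuous.integrable_of_hasCompactSupport hc)
    (fun _ _ => differentiableAt_const _) (fun _ _ => hG.differentiable one_ne_zero _)
  simpa using h

lemma hasDerivAt_fst_slice {G : ℝ × ℝ → ℝ} {x y : ℝ} (hG : DifferentiableAt ℝ G (x, y)) :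
    HasDerivAt (fun u => G (u, y)) (fderiv ℝ G (x, y) (1, 0)) x :=
  hG.hasFDerivAt.comp_hasDerivAt x ((hasDerivAt_id x).prodMk (hasDerivAt_const x y))

lemma hasDerivAt_snd_slice {G : ℝ × ℝ → ℝ} {x y : ℝ} (hG : DifferentiableAt ℝ G (x, y)) :
    HasDerivAt (fun v => G (x, v)) (fderiv ℝ G (x, y) (0, 1)) y :=
  hG.hasFDerivAt.comp_hasDerivAt y ((hasDerivAt_const y x).prodMk (hasDerivAt_id y))

lemma hasDerivAt_rpow_two_mul {a x : ℝ} (hx : 0 < x) :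
    HasDerivAt (fun u : ℝ => u ^ (2 * a)) (2 * a * x ^ (2 * a) / x) x := by
  have h := Real.hasDerivAt_rpow_const (x := x) (p := 2 * a) (Or.inl hx.ne')
  rwa [Real.rpow_sub_one hx.ne', ← mul_div_assoc] at h

/-- The product of a `C¹` function supported in `Q` with a function which is `C¹` at every point
of `Q` is globally `C¹`. -/
lemma contDiff_mul_of_tsupport_subset {g w : ℝ × ℝ → ℝ} {Q : Set (ℝ × ℝ)}
    (hg : ContDiff ℝ 1 g) (hsupp : tsupport g ⊆ Q) (hw : ∀ p ∈ Q, ContDiffAt ℝ 1 w p) :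
    ContDiff ℝ 1 (fun p => g p * w p) :=
  contDiff_iff_contDiffAt.2 fun p => by
    by_cases hp : p ∈ tsupport g
    · exact hg.contDiffAt.mul (hw p (hsupp hp))
    · refine (contDiffAt_const (c := (0 : ℝ))).congr_of_eventuallyEq ?_
      filter_upwards [notMem_tsupport_iff_eventuallyEq.1 hp] with q hq
      simp [hq]

/-- In the driftless case, under the skew symmetry condition `αβ + γδ = 0`, the function
`ρ(x,y) = x^{2α} y^{2δ}` is an invariant density: `∫∫ Lf · ρ = 0` for every `C²`
function `f` with compact support in `(0,∞) × (0,∞)`, where `L` is the generator of the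
Brownian motion with oblique electrostatic repulsion from the sides of the quadrant. -/
theorem power_invariant_density (α β γ δ : ℝ) (hα : 0 < α) (hδ : 0 < δ)
    (hskew : α * β + γ * δ = 0) :
    let ρ : ℝ → ℝ → ℝ := fun x y => x ^ (2 * α) * y ^ (2 * δ)
    ∀ f : ℝ → ℝ → ℝ,
      ContDiff ℝ 2 (Function.uncurry f) →
      HasCompactSupport (Function.uncurry f) →
      tsupport (Function.uncurry f) ⊆ Set.Ioi 0 ×ˢ Set.Ioi 0 →
      (∫ x in Set.Ioi (0:ℝ), ∫ y in Set.Ioi (0:ℝ),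
        ((1/2) * (deriv (deriv (fun u => f u y)) x + deriv (deriv (fun v => f x v)) y)
          + (α / x + β / y) * deriv (fun u => f u y) x
          + (γ / x + δ / y) * deriv (fun v => f x v) y) * ρ x y) = 0 := by
  intro ρ f hf hc hs
  set F := Function.uncurry f
  set Q : Set (ℝ × ℝ) := Set.Ioi 0 ×ˢ Set.Ioi 0
  set D : ℝ × ℝ → ℝ × ℝ → ℝ := fun v p => fderiv ℝ F p v
  have hF1 : ContDiff ℝ 1 F := hf.of_le (by norm_num)
  have hDC (v) : ContDiff ℝ 1 (D v) :=
    (hf.fderiv_right (m := 1) (by norm_num)).clm_apply contDiff_const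
  have hDs (v) : tsupport (D v) ⊆ Q := (tsupport_fderiv_apply_subset ℝ v).trans hs
  have hDc (v) : HasCompactSupport (D v) := hc.fderiv_apply ℝ v
  have hρ : ∀ p ∈ Q, ContDiffAt ℝ 1 (fun p : ℝ × ℝ => ρ p.1 p.2) p := fun p hp =>
    (contDiffAt_fst.rpow_const_of_ne hp.1.ne').mul (contDiffAt_snd.rpow_const_of_ne hp.2.ne')
  -- The integrand is the divergence of the vector field `(A, B)`.
  set A : ℝ × ℝ → ℝ := fun p =>
    D (1, 0) p * (1 / 2 * ρ p.1 p.2) + F p * (β / p.2 * ρ p.1 p.2)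
  set B : ℝ × ℝ → ℝ := fun p =>
    D (0, 1) p * (1 / 2 * ρ p.1 p.2) + F p * (γ / p.1 * ρ p.1 p.2)
  have hAC : ContDiff ℝ 1 A :=
    (contDiff_mul_of_tsupport_subset (hDC _) (hDs _) fun p hp =>
      contDiffAt_const.mul (hρ p hp)).add
    (contDiff_mul_of_tsupport_subset hF1 hs fun p hp =>
      (contDiffAt_const.div contDiffAt_snd hp.2.ne').mul (hρ p hp))
  have hBC : ContDiff ℝ 1 B :=
    (contDiff_mul_of_tsupport_subset (hDC _) (hDs _) fun p hp =>
      contDiffAt_const.mul (hρ p hp)).add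
    (contDiff_mul_of_tsupport_subset hF1 hs fun p hp =>
      (contDiffAt_const.div contDiffAt_fst hp.1.ne').mul (hρ p hp))
  have hAs : tsupport A ⊆ Q := (tsupport_add _ _).trans <| Set.union_subset
    (tsupport_mul_subset_left.trans (hDs _)) (tsupport_mul_subset_left.trans hs)
  have hBs : tsupport B ⊆ Q := (tsupport_add _ _).trans <| Set.union_subset
    (tsupport_mul_subset_left.trans (hDs _)) (tsupport_mul_subset_left.trans hs)
  have hAc : HasCompactSupport A := (hDc _).mul_right.add hc.mul_right
  have hBc : HasCompactSupport B := (hDc _).mul_right.add hc.mul_right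
  obtain ⟨hAi, hA0⟩ := integral_fderiv_apply_eq_zero_s15 hAC hAc (1, 0)
  obtain ⟨hBi, hB0⟩ := integral_fderiv_apply_eq_zero_s15 hBC hBc (0, 1)
  have hx (x y : ℝ) : HasDerivAt (fun u => f u y) (D (1, 0) (x, y)) x :=
    hasDerivAt_fst_slice (hF1.differentiable one_ne_zero _)
  have hy (x y : ℝ) : HasDerivAt (fun v => f x v) (D (0, 1) (x, y)) y :=
    hasDerivAt_snd_slice (hF1.differentiable one_ne_zero _)
  have key : ∀ x ∈ Set.Ioi (0 : ℝ), ∀ y ∈ Set.Ioi (0 : ℝ),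
      ((1/2) * (deriv (deriv (fun u => f u y)) x + deriv (deriv (fun v => f x v)) y)
          + (α / x + β / y) * deriv (fun u => f u y) x
          + (γ / x + δ / y) * deriv (fun v => f x v) y) * ρ x y
        = fderiv ℝ A (x, y) (1, 0) + fderiv ℝ B (x, y) (0, 1) := by
    intro x hx0 y hy0
    have hxx := hasDerivAt_fst_slice ((hDC (1, 0)).differentiable one_ne_zero (x, y))
    have hyy := hasDerivAt_snd_slice ((hDC (0, 1)).differentiable one_ne_zero (x, y))
    have ex : deriv (fun u => f u y) = fun u => D (1, 0) (u, y) :=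
      funext fun u => (hx u y).deriv
    have ey : deriv (fun v => f x v) = fun v => D (0, 1) (x, v) :=
      funext fun v => (hy x v).deriv
    have hρx : HasDerivAt (fun u => ρ u y) (2 * α * x ^ (2 * α) / x * y ^ (2 * δ)) x :=
      (hasDerivAt_rpow_two_mul hx0).mul_const _
    have hρy : HasDerivAt (fun v => ρ x v) (x ^ (2 * α) * (2 * δ * y ^ (2 * δ) / y)) y :=
      (hasDerivAt_rpow_two_mul hy0).const_mul _
    have eA := (hasDerivAt_fst_slice (hAC.differentiable one_ne_zero (x, y))).unique
      ((hxx.mul (hρx.const_mul (1 / 2))).add ((hx x y).mul (hρx.const_mul (β / y))))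
    have eB := (hasDerivAt_snd_slice (hBC.differentiable one_ne_zero (x, y))).unique
      ((hyy.mul (hρy.const_mul (1 / 2))).add ((hy x y).mul (hρy.const_mul (γ / x))))
    rw [eA, eB, ex, ey, hxx.deriv, hyy.deriv]
    have hx1 : x ≠ 0 := ne_of_gt hx0
    have hy1 : y ≠ 0 := ne_of_gt hy0
    simp only [ρ]
    linear_combination (-2 * f x y * x ^ (2 * α) * y ^ (2 * δ) / (x * y)) * hskew
  have hi : Integrable fun p => fderiv ℝ A p (1, 0) + fderiv ℝ B p (0, 1) := hAi.add hBi
  calc _ = ∫ x in Set.Ioi (0 : ℝ), ∫ y in Set.Ioi (0 : ℝ),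
        (fderiv ℝ A (x, y) (1, 0) + fderiv ℝ B (x, y) (0, 1)) :=
      setIntegral_congr_fun measurableSet_Ioi fun x hx0 =>
        setIntegral_congr_fun measurableSet_Ioi fun y hy0 => key x hx0 y hy0
    _ = ∫ p in Q, (fderiv ℝ A p (1, 0) + fderiv ℝ B p (0, 1)) :=
      (setIntegral_prod _ hi.integrableOn).symm
    _ = ∫ p, (fderiv ℝ A p (1, 0) + fderiv ℝ B p (0, 1)) := by
      refine setIntegral_eq_integral_of_forall_compl_eq_zero fun p hp => ?_
      rw [fderiv_of_notMem_tsupport ℝ (fun h => hp (hAs h)),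
        fderiv_of_notMem_tsupport ℝ (fun h => hp (hBs h))]
      simp
    _ = 0 := by rw [integral_add hAi hBi, hA0, hB0, add_zero]
end

section
/- Let β > 0 and γ > 0 be real numbers. For every constant C > 0, the pair of continuous nonnegative functions x(t) = C·t^{β/(β+γ)} and y(t) = ((β+γ)/C)·t^{γ/(β+γ)} satisfies, for all t ≥ 0, x(t) = β∫₀ᵗ y(s)⁻¹ ds and y(t) = γ∫₀ᵗ x(s)⁻¹ ds. In particular, the deterministic singular system with α = δ = 0 admits infinitely many distinct solutions, so uniqueness fails in this degenerate case. -/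
open MeasureTheory

noncomputable section

/-- `(x, y)` is a solution of the degenerate deterministic singular system (case
`α = δ = 0`): `x, y` are continuous nonnegative on `[0,∞)` and
`x(t) = β∫₀ᵗ y(s)⁻¹ ds`, `y(t) = γ∫₀ᵗ x(s)⁻¹ ds`, the integrals being finite. -/
def IsDegSolution (β γ : ℝ) (x y : ℝ → ℝ) : Prop :=
  ContinuousOn x (Set.Ici 0) ∧ ContinuousOn y (Set.Ici 0) ∧
  (∀ t : ℝ, 0 ≤ t → 0 ≤ x t ∧ 0 ≤ y t) ∧
  ∀ t : ℝ, 0 ≤ t →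
    IntegrableOn (fun s => (x s)⁻¹) (Set.Ioc 0 t) volume ∧
    IntegrableOn (fun s => (y s)⁻¹) (Set.Ioc 0 t) volume ∧
    x t = β * ∫ s in Set.Ioc 0 t, (y s)⁻¹ ∧
    y t = γ * ∫ s in Set.Ioc 0 t, (x s)⁻¹

/-- The reciprocal of `c * s ^ q` is integrable on `(0, t]` when `q < 1`. -/
lemma integrableOn_inv_const_mul_rpow (c : ℝ) {q t : ℝ} (hq : q < 1) (ht : 0 ≤ t) :
    IntegrableOn (fun s : ℝ => (c * s ^ q)⁻¹) (Set.Ioc 0 t) volume := by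
  have h : IntegrableOn (fun s : ℝ => s ^ (-q)) (Set.Ioc 0 t) volume :=
    (intervalIntegrable_iff_integrableOn_Ioc_of_le ht).1
      (intervalIntegral.intervalIntegrable_rpow' (by linarith))
  refine IntegrableOn.congr_fun (h.const_mul c⁻¹) (fun s hs => ?_) measurableSet_Ioc
  simp only [mul_inv, Real.rpow_neg hs.1.le]

lemma setIntegral_inv_const_mul_rpow (c : ℝ) {q t : ℝ} (hq : q < 1) (ht : 0 ≤ t) :
    ∫ s in Set.Ioc 0 t, (c * s ^ q)⁻¹ = c⁻¹ * (t ^ (1 - q) / (1 - q)) := by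
  have h : Set.EqOn (fun s : ℝ => (c * s ^ q)⁻¹) (fun s => c⁻¹ * s ^ (-q)) (Set.Ioc 0 t) :=
    fun s hs => by simp only [mul_inv, Real.rpow_neg hs.1.le]
  rw [setIntegral_congr_fun measurableSet_Ioc h, integral_const_mul,
    ← intervalIntegral.integral_of_le ht, integral_rpow (Or.inl (by linarith)),
    neg_add_eq_sub, Real.zero_rpow (by linarith), sub_zero]

lemma isDegSolution_rpow {β γ C : ℝ} (hβ : 0 < β) (hγ : 0 < γ) (hC : 0 < C) :
    IsDegSolution β γ
      (fun t => C * t ^ (β / (β + γ)))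
      (fun t => ((β + γ) / C) * t ^ (γ / (β + γ))) := by
  have hs : 0 < β + γ := add_pos hβ hγ
  have hp : β / (β + γ) < 1 := (div_lt_one hs).2 (by linarith)
  have hq : γ / (β + γ) < 1 := (div_lt_one hs).2 (by linarith)
  have hp' : 1 - β / (β + γ) = γ / (β + γ) := by field_simp; ring
  have hq' : 1 - γ / (β + γ) = β / (β + γ) := by field_simp; ring
  refine ⟨?_, ?_, fun t ht => ⟨by positivity, by positivity⟩, fun t ht =>
    ⟨integrableOn_inv_const_mul_rpow _ hp ht, integrableOn_inv_const_mul_rpow _ hq ht, ?_, ?_⟩⟩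
  · exact (continuous_const.mul (Real.continuous_rpow_const (by positivity))).continuousOn
  · exact (continuous_const.mul (Real.continuous_rpow_const (by positivity))).continuousOn
  · rw [setIntegral_inv_const_mul_rpow _ hq ht, hq']
    field_simp
  · rw [setIntegral_inv_const_mul_rpow _ hp ht, hp']
    field_simp

/-- For `β > 0`, `γ > 0` and every `C > 0`, the pair
`x(t) = C·t^{β/(β+γ)}`, `y(t) = ((β+γ)/C)·t^{γ/(β+γ)}` solves the degenerate system
`x(t) = β∫₀ᵗ y(s)⁻¹ ds`, `y(t) = γ∫₀ᵗ x(s)⁻¹ ds`; in particular the degenerate system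
(case `α = δ = 0`) admits infinitely many distinct solutions, so uniqueness fails. -/
theorem deg_solutions_not_unique (β γ : ℝ) (hβ : 0 < β) (hγ : 0 < γ) :
    (∀ C : ℝ, 0 < C →
      IsDegSolution β γ
        (fun t => C * t ^ (β / (β + γ)))
        (fun t => ((β + γ) / C) * t ^ (γ / (β + γ)))) ∧
    {p : (ℝ → ℝ) × (ℝ → ℝ) | IsDegSolution β γ p.1 p.2}.Infinite := by
  refine ⟨fun C hC => isDegSolution_rpow hβ hγ hC, ?_⟩
  refine Set.infinite_of_injOn_mapsTo
    (f := fun C : ℝ => (fun t : ℝ => C * t ^ (β / (β + γ)),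
      fun t : ℝ => ((β + γ) / C) * t ^ (γ / (β + γ))))
    (fun C _ D _ h => ?_) (fun C hC => isDegSolution_rpow hβ hγ hC) (Set.Ioi_infinite (0 : ℝ))
  simpa using congrFun (congrArg Prod.fst h) 1
end
end
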